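/- arXiv:1510.04727 — 2 statements merged into one kernel-verified Lean document; each statement's English description precedes it below -/
import Mathlib

section
/- Let B be an n×n complex Hermitian positive semi-definite matrix with unit diagonal and largest eigenvalue λ₁, and let ω > 0. For each permutation σ of {1,…,n} let L_σ be the strictly lower triangular part of P_σ B P_σ*. Then for every unit vector z ∈ ℂⁿ: (1/n!) Σ_σ ‖(I + ωL_σ)^{-1} P_σ z‖² ≥ (1 + ωλ₁)^{-2}, the sum being over all n! permutations and ‖·‖ the Euclidean norm. -/
open Matrix
open scoped ComplexOrder

/-- Spectral (operator ℓ²→ℓ²) norm of a complex square matrix. -/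
noncomputable def specNorm {n : ℕ} (M : Matrix (Fin n) (Fin n) ℂ) : ℝ :=
  ‖Matrix.toEuclideanCLM (𝕜 := ℂ) (n := Fin n) M‖

/-- Strictly lower triangular part of a matrix. -/
def lowerTri {n : ℕ} (M : Matrix (Fin n) (Fin n) ℂ) : Matrix (Fin n) (Fin n) ℂ :=
  Matrix.of fun i j => if j < i then M i j else 0

/-- Squared energy seminorm |y|_B² = ⟨By, y⟩. -/
noncomputable def energySq {n : ℕ} (B : Matrix (Fin n) (Fin n) ℂ) (y : Fin n → ℂ) : ℝ :=
  (star y ⬝ᵥ (B *ᵥ y)).re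

/-- Euclidean norm of a vector in ℂⁿ. -/
noncomputable def euclNorm {n : ℕ} (v : Fin n → ℂ) : ℝ :=
  ‖(WithLp.equiv 2 (Fin n → ℂ)).symm v‖

theorem euclNorm_sq {n : ℕ} (v : Fin n → ℂ) : euclNorm v ^ 2 = ∑ i, ‖v i‖ ^ 2 := by
  simp [euclNorm, EuclideanSpace.norm_sq_eq]

theorem euclNorm_nonneg {n : ℕ} (v : Fin n → ℂ) : 0 ≤ euclNorm v := norm_nonneg _

theorem euclNorm_add_smul_le {n : ℕ} (v w : Fin n → ℂ) {r : ℝ} (hr : 0 ≤ r) :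
    euclNorm (v + (r : ℂ) • w) ≤ euclNorm v + r * euclNorm w := by
  have h := norm_add_le (WithLp.toLp 2 v) ((r : ℂ) • WithLp.toLp 2 w)
  rw [norm_smul, Complex.norm_real, Real.norm_of_nonneg hr] at h
  exact h

theorem norm_star_dotProduct_le {n : ℕ} (v w : Fin n → ℂ) :
    ‖star v ⬝ᵥ w‖ ≤ euclNorm v * euclNorm w := by
  have h := norm_inner_le_norm (𝕜 := ℂ) (WithLp.toLp 2 v) (WithLp.toLp 2 w)
  rw [EuclideanSpace.inner_toLp_toLp, dotProduct_comm] at h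
  exact h

theorem star_dotProduct_self {n : ℕ} (v : Fin n → ℂ) :
    star v ⬝ᵥ v = ((euclNorm v ^ 2 : ℝ) : ℂ) := by
  rw [euclNorm_sq]
  simp [dotProduct, Complex.conj_mul']

theorem euclNorm_comp_perm {n : ℕ} (v : Fin n → ℂ) (σ : Equiv.Perm (Fin n)) :
    euclNorm (fun j => v (σ j)) = euclNorm v := by
  rw [← sq_eq_sq₀ (euclNorm_nonneg _) (euclNorm_nonneg _), euclNorm_sq, euclNorm_sq]
  exact Equiv.sum_comp σ fun j => ‖v j‖ ^ 2

/-- Cauchy–Schwarz lower bound for the norm of a resolvent applied to a vector. -/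
theorem euclNorm_sq_le_mul_inv_mulVec {n : ℕ} (A : Matrix (Fin n) (Fin n) ℂ) (hA : IsUnit A.det)
    (v : Fin n → ℂ) :
    euclNorm v ^ 2 ≤ euclNorm (Aᴴ *ᵥ v) * euclNorm (A⁻¹ *ᵥ v) := by
  have h := norm_star_dotProduct_le (Aᴴ *ᵥ v) (A⁻¹ *ᵥ v)
  rw [star_mulVec, conjTranspose_conjTranspose, ← dotProduct_mulVec, mulVec_mulVec,
    mul_nonsing_inv _ hA, one_mulVec, star_dotProduct_self, Complex.norm_real,
    Real.norm_of_nonneg (sq_nonneg _)] at h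
  exact h

theorem det_one_add_smul_lowerTri {n : ℕ} (M : Matrix (Fin n) (Fin n) ℂ) (c : ℂ) :
    (1 + c • lowerTri M).det = 1 := by
  rw [det_of_isLowerTriangular]
  · simp [lowerTri]
  · intro i j hij
    have hij : i < j := hij
    simp [lowerTri, hij.ne, hij.not_gt]

/-- A Hermitian matrix whose eigenvalues are bounded by `c` in absolute value is `c`-Lipschitz. -/
theorem Matrix.IsHermitian.euclNorm_mulVec_sq_le {n : ℕ} {B : Matrix (Fin n) (Fin n) ℂ}
    (hB : B.IsHermitian) {c : ℝ} (hc : ∀ i, |hB.eigenvalues i| ≤ c) (v : Fin n → ℂ) :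
    euclNorm (B *ᵥ v) ^ 2 ≤ c ^ 2 * euclNorm v ^ 2 := by
  have key : ∀ i, inner ℂ (hB.eigenvectorBasis i) (WithLp.toLp 2 (B *ᵥ v)) =
      (hB.eigenvalues i : ℂ) * inner ℂ (hB.eigenvectorBasis i) (WithLp.toLp 2 v) := by
    intro i
    have h1 := hB.mulVec_eigenvectorBasis i
    rw [EuclideanSpace.inner_eq_star_dotProduct, EuclideanSpace.inner_eq_star_dotProduct,
      dotProduct_comm, dotProduct_mulVec]
    have h2 : star (hB.eigenvectorBasis i).ofLp ᵥ* B =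
        (hB.eigenvalues i : ℂ) • star (hB.eigenvectorBasis i).ofLp := by
      have := congrArg star h1
      rw [star_mulVec, hB.eq] at this
      rw [this]
      ext; simp
    rw [h2, smul_dotProduct, dotProduct_comm, smul_eq_mul]
  have e1 := hB.eigenvectorBasis.sum_sq_norm_inner_right (WithLp.toLp 2 (B *ᵥ v))
  have e2 := hB.eigenvectorBasis.sum_sq_norm_inner_right (WithLp.toLp 2 v)
  change _ = euclNorm (B *ᵥ v) ^ 2 at e1
  change _ = euclNorm v ^ 2 at e2
  rw [← e1, ← e2, Finset.mul_sum]
  refine Finset.sum_le_sum fun i _ => ?_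
  rw [key, norm_mul, mul_pow, Complex.norm_real, Real.norm_eq_abs]
  gcongr
  exact hc i

/-- Indicator that `j` precedes `i` in the ordering `σ 0, σ 1, …`. -/
noncomputable def precedes {n : ℕ} (σ : Equiv.Perm (Fin n)) (j i : Fin n) : ℝ :=
  if σ.symm j < σ.symm i then 1 else 0

theorem sum_precedes_mul_perm {n : ℕ} (τ : Equiv.Perm (Fin n)) (j i k : Fin n) :
    ∑ σ : Equiv.Perm (Fin n), precedes σ (τ j) (τ i) * precedes σ (τ j) (τ k) =
      ∑ σ : Equiv.Perm (Fin n), precedes σ j i * precedes σ j k := by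
  rw [← Equiv.sum_comp (Equiv.mulLeft τ)]
  refine Finset.sum_congr rfl fun σ _ => ?_
  simp [precedes, Equiv.Perm.mul_def]

theorem sum_precedes_sq {n : ℕ} {j i : Fin n} (hij : i ≠ j) :
    ∑ σ : Equiv.Perm (Fin n), precedes σ j i * precedes σ j i = n.factorial / 2 := by
  have h := sum_precedes_mul_perm (Equiv.swap i j) j i i
  rw [Equiv.swap_apply_right, Equiv.swap_apply_left] at h
  have h2 : ∑ σ : Equiv.Perm (Fin n), (precedes σ j i * precedes σ j i +
      precedes σ i j * precedes σ i j) = n.factorial := by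
    rw [Finset.sum_congr rfl (g := fun _ => (1 : ℝ))]
    · simp [Fintype.card_perm]
    · intro σ _
      have : σ.symm i ≠ σ.symm j := fun h => hij (σ.symm.injective h)
      unfold precedes
      grind
  rw [Finset.sum_add_distrib] at h2
  linarith

theorem sum_precedes_mul {n : ℕ} {j i k : Fin n} (hij : i ≠ j) (hkj : k ≠ j) (hik : i ≠ k) :
    ∑ σ : Equiv.Perm (Fin n), precedes σ j i * precedes σ j k = n.factorial / 3 := by
  have h := sum_precedes_mul_perm (Equiv.swap i j) j i k
  rw [Equiv.swap_apply_right, Equiv.swap_apply_left, Equiv.swap_apply_of_ne_of_ne hik.symm hkj] at h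
  have h' := sum_precedes_mul_perm (Equiv.swap k j) j i k
  rw [Equiv.swap_apply_right, Equiv.swap_apply_left, Equiv.swap_apply_of_ne_of_ne hik hij] at h'
  have h2 : ∑ σ : Equiv.Perm (Fin n), (precedes σ j i * precedes σ j k +
      precedes σ i j * precedes σ i k + precedes σ k i * precedes σ k j) = n.factorial := by
    rw [Finset.sum_congr rfl (g := fun _ => (1 : ℝ))]
    · simp [Fintype.card_perm]
    · intro σ _
      have h1 : σ.symm i ≠ σ.symm j := fun h => hij (σ.symm.injective h)
      have h2 : σ.symm k ≠ σ.symm j := fun h => hkj (σ.symm.injective h)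
      have h3 : σ.symm i ≠ σ.symm k := fun h => hik (σ.symm.injective h)
      unfold precedes
      grind
  rw [Finset.sum_add_distrib, Finset.sum_add_distrib] at h2
  linarith

theorem norm_sum_sq_eq {n : ℕ} (a : Fin n → ℂ) :
    ‖∑ i, a i‖ ^ 2 = ∑ i, ∑ k, (star (a i) * a k).re := by
  have h : ((‖∑ i, a i‖ ^ 2 : ℝ) : ℂ) = ∑ i, ∑ k, star (a i) * a k := by
    push_cast
    rw [← Complex.conj_mul', map_sum, Finset.sum_mul_sum]
    rfl
  have h' := congrArg Complex.re h
  simpa only [Complex.ofReal_re, Complex.re_sum] using h'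

/-- Second moment of the sum of the terms that `j` precedes in a uniformly random ordering. -/
theorem sum_norm_sum_precedes_sq {n : ℕ} (j : Fin n) (a : Fin n → ℂ) (ha : a j = 0) :
    ∑ σ : Equiv.Perm (Fin n), ‖∑ i, (precedes σ j i : ℂ) * a i‖ ^ 2 =
      n.factorial * (‖∑ i, a i‖ ^ 2 / 3 + (∑ i, ‖a i‖ ^ 2) / 6) := by
  have h1 : ∀ σ : Equiv.Perm (Fin n), ‖∑ i, (precedes σ j i : ℂ) * a i‖ ^ 2 =
      ∑ i, ∑ k, precedes σ j i * precedes σ j k * (star (a i) * a k).re := by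
    intro σ
    rw [norm_sum_sq_eq]
    refine Finset.sum_congr rfl fun i _ => Finset.sum_congr rfl fun k _ => ?_
    rw [← Complex.re_ofReal_mul]
    congr 1
    simp
    ring
  have h2 : ∀ i k, ∑ σ : Equiv.Perm (Fin n),
      precedes σ j i * precedes σ j k * (star (a i) * a k).re =
      n.factorial * ((star (a i) * a k).re / 3 + if i = k then ‖a i‖ ^ 2 / 6 else 0) := by
    intro i k
    by_cases hi : i = j
    · simp [hi, ha]
    by_cases hk : k = j
    · simp +contextual [hk, ha, hi]
    rw [← Finset.sum_mul]
    by_cases hik : i = k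
    · subst hik
      have : (star (a i) * a i).re = ‖a i‖ ^ 2 := by
        rw [Complex.star_def, Complex.conj_mul']
        norm_cast
      rw [sum_precedes_sq hi, if_pos rfl, this]
      ring
    · rw [sum_precedes_mul hi hk hik, if_neg hik]
      ring
  simp_rw [h1]
  rw [Finset.sum_comm]
  simp_rw [Finset.sum_comm (s := (Finset.univ : Finset (Equiv.Perm (Fin n)))), h2, ← Finset.mul_sum,
    Finset.sum_add_distrib, ← Finset.sum_div, ← norm_sum_sq_eq]
  simp [Finset.sum_div]

theorem euclNorm_conjTranspose_lowerTri_sq {n : ℕ} {B : Matrix (Fin n) (Fin n) ℂ}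
    (hB : B.IsHermitian) (z : Fin n → ℂ) (σ : Equiv.Perm (Fin n)) :
    euclNorm ((lowerTri (B.submatrix σ σ))ᴴ *ᵥ fun j => z (σ j)) ^ 2 =
      ∑ j, ‖∑ i, (precedes σ j i : ℂ) * ((B - 1) j i * z i)‖ ^ 2 := by
  rw [euclNorm_sq]
  refine Fintype.sum_equiv σ _ _ fun p => ?_
  rw [mulVec, dotProduct]
  congr 2
  refine Fintype.sum_equiv σ _ _ fun q => ?_
  by_cases hpq : p < q
  · have h := hB.apply (σ p) (σ q)
    simp only [Complex.star_def] at h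
    simp [lowerTri, precedes, hpq, hpq.ne, h]
  · simp [lowerTri, precedes, hpq]

theorem sum_euclNorm_conjTranspose_lowerTri_sq_le {n : ℕ} {B : Matrix (Fin n) (Fin n) ℂ}
    (hB : B.PosSemidef) (hdiag : ∀ i, B i i = 1) {c : ℝ} (h1c : 1 ≤ c)
    (hc : ∀ v, euclNorm (B *ᵥ v) ^ 2 ≤ c ^ 2 * euclNorm v ^ 2)
    (z : Fin n → ℂ) (hz : euclNorm z = 1) :
    ∑ σ : Equiv.Perm (Fin n),
      euclNorm ((lowerTri (B.submatrix σ σ))ᴴ *ᵥ fun j => z (σ j)) ^ 2 ≤ n.factorial * c ^ 2 := by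
  have hz2 : ∑ i, ‖z i‖ ^ 2 = 1 := by rw [← euclNorm_sq, hz, one_pow]
  simp_rw [euclNorm_conjTranspose_lowerTri_sq hB.1]
  have hmoment := fun j => sum_norm_sum_precedes_sq j (fun i => (B - 1) j i * z i)
    (by simp [hdiag])
  rw [Finset.sum_comm]
  simp_rw [hmoment]
  rw [← Finset.mul_sum, Finset.sum_add_distrib,
    ← Finset.sum_div, ← Finset.sum_div]
  gcongr
  have hfirst : ∑ j, ‖∑ i, (B - 1) j i * z i‖ ^ 2 ≤ c ^ 2 + 1 := by
    have e : ∑ j, ‖∑ i, (B - 1) j i * z i‖ ^ 2 = euclNorm ((B - 1) *ᵥ z) ^ 2 := by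
      rw [euclNorm_sq]; rfl
    have e2 : euclNorm ((B - 1) *ᵥ z) ^ 2 =
        euclNorm (B *ᵥ z) ^ 2 - 2 * (star z ⬝ᵥ (B *ᵥ z)).re + 1 := by
      rw [← hz2, euclNorm_sq, euclNorm_sq, dotProduct, Complex.re_sum, Finset.mul_sum,
        ← Finset.sum_sub_distrib, ← Finset.sum_add_distrib]
      refine Finset.sum_congr rfl fun i _ => ?_
      rw [sub_mulVec, one_mulVec, Pi.sub_apply, ← Complex.normSq_eq_norm_sq,
        ← Complex.normSq_eq_norm_sq, ← Complex.normSq_eq_norm_sq, Complex.normSq_sub]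
      simp
      ring
    have h3 : 0 ≤ (star z ⬝ᵥ (B *ᵥ z)).re :=
      (Complex.le_def.1 (hB.dotProduct_mulVec_nonneg z)).1
    have h4 := hc z
    rw [hz] at h4
    rw [e, e2]
    linarith
  have hsecond : ∑ j, ∑ i, ‖(B - 1) j i * z i‖ ^ 2 ≤ c ^ 2 := by
    rw [Finset.sum_comm]
    calc _ ≤ ∑ i, c ^ 2 * ‖z i‖ ^ 2 := ?_
      _ = c ^ 2 := by rw [← Finset.mul_sum, hz2, mul_one]
    refine Finset.sum_le_sum fun i _ => ?_
    simp_rw [norm_mul, mul_pow]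
    rw [← Finset.sum_mul]
    gcongr
    have h := hc (Pi.single i 1)
    rw [euclNorm_sq, euclNorm_sq] at h
    have e : ∑ k, ‖(Pi.single i 1 : Fin n → ℂ) k‖ ^ 2 = 1 := by
      rw [Finset.sum_eq_single i] <;> simp +contextual
    rw [e, mul_one] at h
    refine le_trans (Finset.sum_le_sum fun j _ => ?_) h
    by_cases hji : j = i
    · subst hji; simp [hdiag]
    · simp [hji]
  nlinarith

/-- Tangent-line form of the inequality between harmonic and arithmetic means. -/
theorem inv_le_average_of_one_le_mul {ι : Type*} [Fintype ι] {t y : ι → ℝ} {C N : ℝ}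
    (hcard : (Fintype.card ι : ℝ) = N) (hN : 0 < N) (hC : 0 < C) (ht : ∀ i, 0 < t i) (hty : ∀ i, 1 ≤ t i * y i)
    (hsum : ∑ i, t i ≤ N * C) :
    C⁻¹ ≤ N⁻¹ * ∑ i, y i := by
  have h : ∀ i, 2 * C⁻¹ - t i * C⁻¹ ^ 2 ≤ y i := by
    intro i
    have h1 : (t i)⁻¹ ≤ y i := by
      rw [inv_le_iff_one_le_mul₀ (ht i), mul_comm]
      exact hty i
    refine le_trans ?_ h1
    have h2 : (t i)⁻¹ - (2 * C⁻¹ - t i * C⁻¹ ^ 2) = t i * ((t i)⁻¹ - C⁻¹) ^ 2 := by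
      have := (ht i).ne'
      field_simp
      ring
    have h3 : 0 ≤ t i * ((t i)⁻¹ - C⁻¹) ^ 2 := mul_nonneg (ht i).le (sq_nonneg _)
    linarith
  have hs := Finset.sum_le_sum fun i (_ : i ∈ Finset.univ) => h i
  rw [Finset.sum_sub_distrib, ← Finset.sum_mul (f := t)] at hs
  simp only [Finset.sum_const, Finset.card_univ, nsmul_eq_mul, hcard] at hs
  have h5 : (∑ i, t i) * C⁻¹ ^ 2 ≤ N * C⁻¹ := by
    calc _ ≤ N * C * C⁻¹ ^ 2 := by gcongr
      _ = _ := by field_simp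
  rw [le_inv_mul_iff₀ hN]
  linarith

/-- The squared norm of a resolvent applied to a unit vector is bounded below in terms of the
adjoint of the triangular part, for any choice of the weight `c`. -/
theorem one_le_mul_euclNorm_inv_mulVec_sq {n : ℕ} (M : Matrix (Fin n) (Fin n) ℂ) {v : Fin n → ℂ}
    (hv : euclNorm v = 1) {ω c : ℝ} (hω : 0 < ω) (hpos : 0 < c) :
    1 ≤ (1 + ω * c) * (1 + ω / c * euclNorm ((lowerTri M)ᴴ *ᵥ v) ^ 2) *
      euclNorm ((1 + (ω : ℂ) • lowerTri M)⁻¹ *ᵥ v) ^ 2 := by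
  have h := euclNorm_sq_le_mul_inv_mulVec (1 + (ω : ℂ) • lowerTri M)
    (by rw [det_one_add_smul_lowerTri]; exact isUnit_one) v
  have hA : (1 + (ω : ℂ) • lowerTri M)ᴴ *ᵥ v =
      v + (ω : ℂ) • ((lowerTri M)ᴴ *ᵥ v) := by
    rw [conjTranspose_add, conjTranspose_one, conjTranspose_smul, add_mulVec, one_mulVec,
      smul_mulVec]
    simp
  have htri := euclNorm_add_smul_le v ((lowerTri M)ᴴ *ᵥ v) hω.le
  rw [hA, hv, one_pow] at h
  rw [hv] at htri
  set x := euclNorm ((lowerTri M)ᴴ *ᵥ v)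
  set y := euclNorm ((1 + (ω : ℂ) • lowerTri M)⁻¹ *ᵥ v)
  have hy : 0 ≤ y := euclNorm_nonneg _
  have h2 : 1 ≤ (1 + ω * x) * y := h.trans (by gcongr)
  have h3 : (1 + ω * x) ^ 2 ≤ (1 + ω * c) * (1 + ω / c * x ^ 2) := by
    have e : (1 + ω * c) * (1 + ω / c * x ^ 2) - (1 + ω * x) ^ 2 =
        ω / c * (x - c) ^ 2 := by
      field_simp
      ring
    have : 0 ≤ ω / c * (x - c) ^ 2 := by positivity
    linarith
  calc (1 : ℝ) ≤ ((1 + ω * x) * y) ^ 2 := one_le_pow₀ h2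
    _ = (1 + ω * x) ^ 2 * y ^ 2 := mul_pow _ _ _
    _ ≤ _ := by gcongr

/-- Averaged lower bound: (1/n!) Σ_σ ‖(I + ωL_σ)⁻¹ P_σ z‖² ≥ (1 + ωλ₁)⁻² for unit vectors z. -/
theorem averaged_resolvent_lower_bound {n : ℕ} (B : Matrix (Fin n) (Fin n) ℂ)
    (hB : B.PosSemidef) (hdiag : ∀ i, B i i = 1)
    (lam1 : ℝ) (hlam1 : IsGreatest {μ : ℝ | ∃ i, hB.1.eigenvalues i = μ} lam1)
    (ω : ℝ) (hω : 0 < ω)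
    (z : Fin n → ℂ) (hz : euclNorm z = 1) :
    ((1 + ω * lam1)^2)⁻¹ ≤
      (n.factorial : ℝ)⁻¹ *
        ∑ σ : Equiv.Perm (Fin n),
          (euclNorm ((1 + (ω : ℂ) • lowerTri (B.submatrix σ σ))⁻¹ *ᵥ fun j => z (σ j)))^2 := by
  obtain ⟨⟨i₀, hi₀⟩, hub⟩ := hlam1
  have h0 : 0 ≤ lam1 := hi₀ ▸ hB.eigenvalues_nonneg i₀
  have hc : ∀ v, euclNorm (B *ᵥ v) ^ 2 ≤ lam1 ^ 2 * euclNorm v ^ 2 :=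
    hB.1.euclNorm_mulVec_sq_le fun i => by
      rw [abs_of_nonneg (hB.eigenvalues_nonneg i)]
      exact hub ⟨i, rfl⟩
  have h1 : 1 ≤ lam1 := by
    have h := hc (Pi.single i₀ 1)
    rw [euclNorm_sq, euclNorm_sq] at h
    have e : ∑ k, ‖(Pi.single i₀ 1 : Fin n → ℂ) k‖ ^ 2 = 1 := by
      rw [Finset.sum_eq_single i₀] <;> simp +contextual
    have e2 := Finset.single_le_sum (f := fun k => ‖(B *ᵥ Pi.single i₀ 1) k‖ ^ 2)
      (fun k _ => sq_nonneg _) (Finset.mem_univ i₀)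
    simp only [mulVec_single_one, col_apply, hdiag] at e2 h
    rw [e] at h
    norm_num at e2
    nlinarith
  have hpos : 0 < lam1 := by linarith
  have hx := sum_euclNorm_conjTranspose_lowerTri_sq_le hB hdiag h1 hc z hz
  have hcard : (Fintype.card (Equiv.Perm (Fin n)) : ℝ) = n.factorial := by
    rw [Fintype.card_perm, Fintype.card_fin]
  have hN : (0 : ℝ) < n.factorial := by exact_mod_cast n.factorial_pos
  generalize (n.factorial : ℝ) = N at hx hcard hN ⊢
  refine inv_le_average_of_one_le_mul hcard hN (t := fun σ : Equiv.Perm (Fin n) =>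
    (1 + ω * lam1) * (1 + ω / lam1 *
    euclNorm ((lowerTri (B.submatrix σ σ))ᴴ *ᵥ fun j => z (σ j)) ^ 2))
    (by positivity) (fun σ => by positivity) (fun σ => ?_) ?_
  · exact one_le_mul_euclNorm_inv_mulVec_sq _ ((euclNorm_comp_perm z σ).trans hz) hω hpos
  · rw [← Finset.mul_sum, Finset.sum_add_distrib, ← Finset.mul_sum]
    simp only [Finset.sum_const, Finset.card_univ, nsmul_eq_mul, mul_one, hcard]
    calc _ ≤ (1 + ω * lam1) * (N + ω / lam1 * (N * lam1 ^ 2)) := by gcongr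
      _ = _ := by
        field_simp
end

section
/- Let B be an n×n complex Hermitian positive semi-definite matrix with unit diagonal, λ₁ its largest eigenvalue, λ_r its smallest nonzero eigenvalue, κ̄ = λ₁/λ_r, and fix ω ∈ (0,2). For each permutation σ of {1,…,n} set Q_σ = I − ω P_σ*(I + ωL_σ)^{-1} P_σ B, where L_σ is the strictly lower triangular part of P_σ B P_σ*. Then for every y ∈ ℂⁿ: (1/n!) Σ_σ ⟨B Q_σ y, Q_σ y⟩ ≤ (1 − ω(2−ω)λ₁ / ((1 + ωλ₁)² κ̄)) · ⟨By, y⟩, the sum being over all n! permutations. -/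
open Matrix
open scoped ComplexOrder

/-- The real part of the standard inner product on ℂⁿ. -/
def reDot {n : ℕ} (u v : Fin n → ℂ) : ℝ :=
  (star u ⬝ᵥ v).re

section ReDot

variable {n : ℕ} (u v w : Fin n → ℂ) (M : Matrix (Fin n) (Fin n) ℂ)

lemma reDot_comm : reDot u v = reDot v u := by
  rw [reDot, reDot, star_dotProduct]
  simp

lemma reDot_add_left : reDot (u + v) w = reDot u w + reDot v w := by
  simp [reDot]

lemma reDot_add_right : reDot u (v + w) = reDot u v + reDot u w := by
  simp [reDot]

lemma reDot_sub_left : reDot (u - v) w = reDot u w - reDot v w := by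
  simp [reDot]

lemma reDot_sub_right : reDot u (v - w) = reDot u v - reDot u w := by
  simp [reDot]

lemma reDot_smul_left (c : ℝ) : reDot ((c : ℂ) • u) v = c * reDot u v := by
  simp [reDot]

lemma reDot_smul_right (c : ℝ) : reDot u ((c : ℂ) • v) = c * reDot u v := by
  simp [reDot]

lemma reDot_mulVec_right : reDot u (M *ᵥ v) = reDot (Mᴴ *ᵥ u) v := by
  simp only [reDot, star_mulVec, dotProduct_mulVec, conjTranspose_conjTranspose]

lemma reDot_self_eq_sum : reDot u u = ∑ i, Complex.normSq (u i) := by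
  simp [reDot, dotProduct, Complex.normSq_apply]

lemma reDot_self_nonneg : 0 ≤ reDot u u := by
  rw [reDot_self_eq_sum]
  exact Finset.sum_nonneg fun i _ => Complex.normSq_nonneg _

lemma two_mul_reDot_le (c : ℝ) :
    2 * c * reDot u v ≤ c ^ 2 * reDot u u + reDot v v := by
  have h := reDot_self_nonneg ((c : ℂ) • u - v)
  simp only [reDot_sub_left, reDot_sub_right, reDot_smul_left, reDot_smul_right,
    reDot_comm v u] at h
  linarith

end ReDot

lemma energySq_eq_reDot {n : ℕ} (B : Matrix (Fin n) (Fin n) ℂ) (y : Fin n → ℂ) :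
    energySq B y = reDot y (B *ᵥ y) := rfl

lemma Matrix.IsHermitian.exists_eigen_coordinates {n : ℕ} {B : Matrix (Fin n) (Fin n) ℂ}
    (hB : B.IsHermitian) (y : Fin n → ℂ) :
    ∃ x : Fin n → ℂ, reDot y y = ∑ i, Complex.normSq (x i) ∧
      energySq B y = ∑ i, hB.eigenvalues i * Complex.normSq (x i) ∧
      reDot (B *ᵥ y) (B *ᵥ y) = ∑ i, hB.eigenvalues i ^ 2 * Complex.normSq (x i) := by
  set U : Matrix (Fin n) (Fin n) ℂ := (hB.eigenvectorUnitary : Matrix (Fin n) (Fin n) ℂ)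
  have hUU : U * Uᴴ = 1 := Unitary.coe_mul_star_self hB.eigenvectorUnitary
  have hUU' : Uᴴ * U = 1 := Unitary.coe_star_mul_self hB.eigenvectorUnitary
  have hBU : B = U * diagonal (fun i => (hB.eigenvalues i : ℂ)) * Uᴴ := hB.spectral_theorem
  have isometry (a b : Fin n → ℂ) : reDot (U *ᵥ a) (U *ᵥ b) = reDot a b := by
    rw [reDot_mulVec_right, mulVec_mulVec, hUU', one_mulVec]
  have hy : y = U *ᵥ (Uᴴ *ᵥ y) := by rw [mulVec_mulVec, hUU, one_mulVec]
  have hBy : B *ᵥ y = U *ᵥ (diagonal (fun i => (hB.eigenvalues i : ℂ)) *ᵥ (Uᴴ *ᵥ y)) := by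
    rw [mulVec_mulVec, mulVec_mulVec, ← hBU]
  refine ⟨Uᴴ *ᵥ y, ?_, ?_, ?_⟩
  · rw [← reDot_self_eq_sum, ← isometry (Uᴴ *ᵥ y), ← hy]
  · rw [energySq_eq_reDot, hBy]
    nth_rewrite 1 [hy]
    rw [isometry]
    simp only [reDot, dotProduct, mulVec_diagonal, Complex.re_sum]
    refine Finset.sum_congr rfl fun i _ => ?_
    simp [Complex.normSq_apply]
    ring
  · rw [hBy, isometry, reDot_self_eq_sum]
    refine Finset.sum_congr rfl fun i _ => ?_
    rw [mulVec_diagonal, Complex.normSq_mul, Complex.normSq_ofReal, sq]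

lemma Matrix.PosSemidef.energySq_nonneg {n : ℕ} {B : Matrix (Fin n) (Fin n) ℂ}
    (hB : B.PosSemidef) (y : Fin n → ℂ) : 0 ≤ energySq B y :=
  (Complex.nonneg_iff.mp (hB.dotProduct_mulVec_nonneg y)).1

section EigenvalueBounds

variable {n : ℕ} {B : Matrix (Fin n) (Fin n) ℂ} (hB : B.PosSemidef) {c : ℝ}

lemma Matrix.PosSemidef.energySq_le (hc : ∀ i, hB.1.eigenvalues i ≤ c) (y : Fin n → ℂ) :
    energySq B y ≤ c * reDot y y := by
  obtain ⟨x, h₀, h₁, -⟩ := hB.1.exists_eigen_coordinates y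
  rw [h₀, h₁, Finset.mul_sum]
  exact Finset.sum_le_sum fun i _ => mul_le_mul_of_nonneg_right (hc i) (Complex.normSq_nonneg _)

lemma Matrix.PosSemidef.reDot_mulVec_self_le (hc : ∀ i, hB.1.eigenvalues i ≤ c)
    (y : Fin n → ℂ) : reDot (B *ᵥ y) (B *ᵥ y) ≤ c * energySq B y := by
  obtain ⟨x, -, h₁, h₂⟩ := hB.1.exists_eigen_coordinates y
  rw [h₁, h₂, Finset.mul_sum]
  refine Finset.sum_le_sum fun i _ => ?_
  rw [← mul_assoc, sq]
  exact mul_le_mul_of_nonneg_right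
    (mul_le_mul_of_nonneg_right (hc i) (hB.eigenvalues_nonneg i)) (Complex.normSq_nonneg _)

lemma Matrix.PosSemidef.mul_energySq_le
    (hc : ∀ i, hB.1.eigenvalues i ≠ 0 → c ≤ hB.1.eigenvalues i) (y : Fin n → ℂ) :
    c * energySq B y ≤ reDot (B *ᵥ y) (B *ᵥ y) := by
  obtain ⟨x, -, h₁, h₂⟩ := hB.1.exists_eigen_coordinates y
  rw [h₁, h₂, Finset.mul_sum]
  refine Finset.sum_le_sum fun i _ => ?_
  rw [← mul_assoc, sq]
  refine mul_le_mul_of_nonneg_right ?_ (Complex.normSq_nonneg _)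
  by_cases h : hB.1.eigenvalues i = 0
  · simp [h]
  · exact mul_le_mul_of_nonneg_right (hc i h) (hB.eigenvalues_nonneg i)

end EigenvalueBounds

/-- The part of `B` that is strictly lower triangular after reordering the indices by `σ`. -/
def permLower {n : ℕ} (B : Matrix (Fin n) (Fin n) ℂ) (σ : Equiv.Perm (Fin n)) :
    Matrix (Fin n) (Fin n) ℂ :=
  Matrix.of fun i j => if σ.symm j < σ.symm i then B i j else 0

section Splitting

variable {n : ℕ} {B : Matrix (Fin n) (Fin n) ℂ} (σ : Equiv.Perm (Fin n))

lemma eq_one_add_permLower (hB : B.IsHermitian) (hdiag : ∀ i, B i i = 1) :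
    B = 1 + permLower B σ + (permLower B σ)ᴴ := by
  ext i j
  have hij := hB.apply i j
  rcases lt_trichotomy (σ.symm i) (σ.symm j) with h | h | h
  · have : i ≠ j := by rintro rfl; exact h.false
    simp [permLower, h, h.not_gt, this, hij]
  · obtain rfl := σ.symm.injective h
    simp [permLower, hdiag]
  · have : i ≠ j := by rintro rfl; exact h.false
    simp [permLower, h, h.not_gt, this]

lemma two_mul_reDot_permLower (hB : B.IsHermitian) (hdiag : ∀ i, B i i = 1) (z : Fin n → ℂ) :
    2 * reDot z (permLower B σ *ᵥ z) = energySq B z - reDot z z := by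
  rw [energySq_eq_reDot]
  nth_rewrite 2 [eq_one_add_permLower σ hB hdiag]
  rw [add_mulVec, add_mulVec, one_mulVec, reDot_add_right, reDot_add_right,
    reDot_mulVec_right z z (permLower B σ)ᴴ, conjTranspose_conjTranspose,
    reDot_comm (permLower B σ *ᵥ z)]
  ring

/-- Energy balance of a relaxation step with relaxation parameter `ω`. -/
lemma energySq_sub_smul (hB : B.IsHermitian) (hdiag : ∀ i, B i i = 1) (ω : ℝ)
    {y w : Fin n → ℂ} (hw : w + (ω : ℂ) • (permLower B σ *ᵥ w) = B *ᵥ y) :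
    energySq B (y - (ω : ℂ) • w) = energySq B y - ω * (2 - ω) * reDot w w := by
  have h₁ := two_mul_reDot_permLower σ hB hdiag w
  have h₂ : reDot w w + ω * reDot w (permLower B σ *ᵥ w) = reDot w (B *ᵥ y) := by
    rw [← hw, reDot_add_right, reDot_smul_right]
  have h₃ : reDot y (B *ᵥ w) = reDot w (B *ᵥ y) := by
    rw [reDot_mulVec_right, hB.eq, reDot_comm]
  simp only [energySq_eq_reDot, mulVec_sub, mulVec_smul, reDot_sub_left, reDot_sub_right,
    reDot_smul_left, reDot_smul_right] at h₁ ⊢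
  rw [h₃]
  linear_combination (2 * ω) * h₂ - ω ^ 2 * h₁

/-- The solution computed in the reordered coordinates solves the original-order system. -/
lemma permLower_solve (ω : ℂ) (z : Fin n → ℂ) :
    let w : Fin n → ℂ := fun i =>
      ((1 + ω • lowerTri (B.submatrix σ σ))⁻¹ *ᵥ fun j => z (σ j)) (σ.symm i)
    w + ω • (permLower B σ *ᵥ w) = z := by
  intro w
  set A := 1 + ω • lowerTri (B.submatrix σ σ) with hA
  have hdet : A.det = 1 := by
    rw [det_of_isLowerTriangular]
    · simp [hA, lowerTri]
    · intro i j hij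
      have hij' : i < j := hij
      simp [hA, lowerTri, hij'.not_gt, hij'.ne]
  have hsolve : A *ᵥ (A⁻¹ *ᵥ fun j => z (σ j)) = fun j => z (σ j) := by
    rw [mulVec_mulVec, mul_nonsing_inv _ (by simp [hdet]), one_mulVec]
  have hT : A = (1 + ω • permLower B σ).submatrix σ σ := by
    ext i j
    simp [hA, lowerTri, permLower, one_apply]
  have hw : A⁻¹ *ᵥ (fun j => z (σ j)) = w ∘ σ := by
    ext i
    simp [w, hA]
  rw [hw, hT, submatrix_mulVec_equiv] at hsolve
  ext i
  have := congrFun hsolve (σ.symm i)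
  simpa [Function.comp_def, add_mulVec, smul_mulVec] using this

end Splitting

section Counting

variable {n : ℕ}

lemma sum_perm_swap (i j : Fin n) (f : (Fin n → Fin n) → ℝ) :
    ∑ σ : Equiv.Perm (Fin n), f (fun k => σ.symm (Equiv.swap i j k)) =
      ∑ σ : Equiv.Perm (Fin n), f σ.symm := by
  rw [← Equiv.sum_comp (Equiv.mulLeft (Equiv.swap i j)) fun σ => f σ.symm]
  refine Finset.sum_congr rfl fun σ _ => congrArg f ?_
  ext k
  simp [Equiv.Perm.mul_def]

lemma sum_perm_one : ∑ _σ : Equiv.Perm (Fin n), (1 : ℝ) = n.factorial := by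
  simp [Fintype.card_perm]

lemma sum_perm_symm_lt {i j : Fin n} (hij : i ≠ j) :
    ∑ σ : Equiv.Perm (Fin n), (if σ.symm j < σ.symm i then (1 : ℝ) else 0) =
      n.factorial / 2 := by
  have h := sum_perm_swap i j fun f => if f j < f i then 1 else 0
  simp only [Equiv.swap_apply_left, Equiv.swap_apply_right] at h
  have hsum : ∑ σ : Equiv.Perm (Fin n), ((if σ.symm j < σ.symm i then (1 : ℝ) else 0) +
      if σ.symm i < σ.symm j then 1 else 0) = n.factorial := by
    rw [← sum_perm_one]
    refine Finset.sum_congr rfl fun σ _ => ?_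
    have hne : σ.symm i ≠ σ.symm j := σ.symm.injective.ne hij
    grind
  rw [Finset.sum_add_distrib, h] at hsum
  linarith

lemma sum_perm_symm_lt_and_lt {i j k : Fin n} (hij : i ≠ j) (hkj : k ≠ j) (hik : i ≠ k) :
    ∑ σ : Equiv.Perm (Fin n),
      (if σ.symm j < σ.symm i ∧ σ.symm j < σ.symm k then (1 : ℝ) else 0) = n.factorial / 3 := by
  have h₁ := sum_perm_swap i j fun f => if f j < f i ∧ f j < f k then 1 else 0
  have h₂ := sum_perm_swap k j fun f => if f j < f i ∧ f j < f k then 1 else 0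
  simp only [Equiv.swap_apply_left, Equiv.swap_apply_right,
    Equiv.swap_apply_of_ne_of_ne hik.symm hkj] at h₁
  simp only [Equiv.swap_apply_left, Equiv.swap_apply_right,
    Equiv.swap_apply_of_ne_of_ne hik hij] at h₂
  have hsum : ∑ σ : Equiv.Perm (Fin n),
      ((if σ.symm j < σ.symm i ∧ σ.symm j < σ.symm k then (1 : ℝ) else 0) +
        (if σ.symm i < σ.symm j ∧ σ.symm i < σ.symm k then 1 else 0) +
        if σ.symm k < σ.symm i ∧ σ.symm k < σ.symm j then 1 else 0) = n.factorial := by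
    rw [← sum_perm_one]
    refine Finset.sum_congr rfl fun σ _ => ?_
    have hne₁ : σ.symm i ≠ σ.symm j := σ.symm.injective.ne hij
    have hne₂ : σ.symm k ≠ σ.symm j := σ.symm.injective.ne hkj
    have hne₃ : σ.symm i ≠ σ.symm k := σ.symm.injective.ne hik
    grind
  rw [Finset.sum_add_distrib, Finset.sum_add_distrib, h₁, h₂] at hsum
  linarith

lemma normSq_sum_eq {ι : Type*} (s : Finset ι) (a : ι → ℂ) :
    Complex.normSq (∑ i ∈ s, a i) = ∑ i ∈ s, ∑ k ∈ s, (a i * star (a k)).re := by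
  rw [← Complex.ofReal_re (Complex.normSq _), Complex.normSq_eq_conj_mul_self, mul_comm, map_sum,
    Finset.sum_mul_sum]
  simp only [Complex.re_sum, starRingEnd_apply]

/-- Second moment of the sum of the entries that a random ordering places after `j`. -/
lemma sum_perm_normSq_sum_after (j : Fin n) {a : Fin n → ℂ} (ha : a j = 0) :
    ∑ σ : Equiv.Perm (Fin n),
        Complex.normSq (∑ i, if σ.symm j < σ.symm i then a i else 0) =
      n.factorial / 3 * Complex.normSq (∑ i, a i) +
        n.factorial / 6 * ∑ i, Complex.normSq (a i) := by
  have hterm (σ : Equiv.Perm (Fin n)) (i k : Fin n) :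
      ((if σ.symm j < σ.symm i then a i else 0) *
        star (if σ.symm j < σ.symm k then a k else 0)).re =
      (if σ.symm j < σ.symm i ∧ σ.symm j < σ.symm k then (1 : ℝ) else 0) *
        (a i * star (a k)).re := by
    split_ifs <;> simp_all
  have hpair (i k : Fin n) :
      (∑ σ : Equiv.Perm (Fin n),
        if σ.symm j < σ.symm i ∧ σ.symm j < σ.symm k then (1 : ℝ) else 0) * (a i * star (a k)).re =
      n.factorial / 3 * (a i * star (a k)).re +
        if i = k then n.factorial / 6 * Complex.normSq (a i) else 0 := by
    by_cases hij : i = j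
    · simp [hij, ha]
    by_cases hkj : k = j
    · simp [hkj, ha, hij]
    by_cases hik : i = k
    · subst hik
      simp only [and_self, sum_perm_symm_lt hij, if_true]
      rw [← starRingEnd_apply, Complex.mul_conj, Complex.ofReal_re]
      ring
    · rw [sum_perm_symm_lt_and_lt hij hkj hik, if_neg hik, add_zero]
  simp only [normSq_sum_eq Finset.univ, hterm]
  rw [Finset.sum_comm, Finset.mul_sum, Finset.mul_sum, ← Finset.sum_add_distrib]
  refine Finset.sum_congr rfl fun i _ => ?_
  rw [Finset.sum_comm]
  simp only [← Finset.sum_mul, hpair]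
  rw [Finset.sum_add_distrib, ← Finset.mul_sum, Finset.sum_ite_eq, if_pos (Finset.mem_univ i)]

end Counting

section SecondMoment

variable {n : ℕ} {B : Matrix (Fin n) (Fin n) ℂ}

lemma sum_reDot_permLower_conjTranspose (hB : B.IsHermitian) (hdiag : ∀ i, B i i = 1)
    (z : Fin n → ℂ) :
    ∑ σ : Equiv.Perm (Fin n),
        reDot ((permLower B σ)ᴴ *ᵥ z) ((permLower B σ)ᴴ *ᵥ z) =
      n.factorial / 3 * reDot (B *ᵥ z - z) (B *ᵥ z - z) +
        n.factorial / 6 *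
          ∑ i, (reDot (B *ᵥ Pi.single i 1) (B *ᵥ Pi.single i 1) - 1) * Complex.normSq (z i) := by
  have hoff (j : Fin n) :
      (∑ i, if i = j then 0 else star (B i j) * z i) = (B *ᵥ z - z) j := by
    have h (i : Fin n) : (if i = j then 0 else star (B i j) * z i) =
        B j i * z i - if i = j then z i else 0 := by
      rw [hB.apply]
      split_ifs with hij
      · simp [hij, hdiag]
      · simp
    simp only [h, Finset.sum_sub_distrib]
    simp [mulVec, dotProduct]
  have hcol (i : Fin n) :
      ∑ j, Complex.normSq (if i = j then 0 else star (B i j) * z i) =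
        (reDot (B *ᵥ Pi.single i 1) (B *ᵥ Pi.single i 1) - 1) * Complex.normSq (z i) := by
    have h (j : Fin n) : Complex.normSq (if i = j then 0 else star (B i j) * z i) =
        (Complex.normSq (B j i) - if i = j then 1 else 0) * Complex.normSq (z i) := by
      rw [hB.apply]
      split_ifs with hij
      · simp [hij, hdiag]
      · simp
    simp only [h, ← Finset.sum_mul, Finset.sum_sub_distrib]
    simp [reDot_self_eq_sum]
  simp only [← hcol]
  rw [Finset.sum_comm (f := fun i j => Complex.normSq (if i = j then 0 else star (B i j) * z i)),
    reDot_self_eq_sum (B *ᵥ z - z), Finset.mul_sum, Finset.mul_sum, ← Finset.sum_add_distrib]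
  simp only [reDot_self_eq_sum]
  rw [Finset.sum_comm]
  refine Finset.sum_congr rfl fun j _ => ?_
  rw [← hoff, ← sum_perm_normSq_sum_after j (by simp)]
  refine Finset.sum_congr rfl fun σ _ => congrArg _ ?_
  simp only [mulVec, dotProduct]
  refine Finset.sum_congr rfl fun i _ => ?_
  by_cases hij : i = j
  · simp [hij, permLower]
  · by_cases h : σ.symm j < σ.symm i <;> simp [hij, h, permLower]

lemma sum_reDot_add_smul_permLower_conjTranspose_le (hB : B.PosSemidef) (hdiag : ∀ i, B i i = 1)
    {c ω : ℝ} (hc : ∀ i, hB.1.eigenvalues i ≤ c) (hc1 : 1 ≤ c) (hω : 0 ≤ ω)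
    (z : Fin n → ℂ) :
    ∑ σ : Equiv.Perm (Fin n),
        reDot (z + (ω : ℂ) • ((permLower B σ)ᴴ *ᵥ z)) (z + (ω : ℂ) • ((permLower B σ)ᴴ *ᵥ z)) ≤
      n.factorial * ((1 + ω * c) ^ 2 * reDot z z) := by
  have hexpand (σ : Equiv.Perm (Fin n)) :
      reDot (z + (ω : ℂ) • ((permLower B σ)ᴴ *ᵥ z)) (z + (ω : ℂ) • ((permLower B σ)ᴴ *ᵥ z)) =
        reDot z z + ω * (energySq B z - reDot z z) +
          ω ^ 2 * reDot ((permLower B σ)ᴴ *ᵥ z) ((permLower B σ)ᴴ *ᵥ z) := by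
    rw [← two_mul_reDot_permLower σ hB.1 hdiag z]
    have h : reDot z ((permLower B σ)ᴴ *ᵥ z) = reDot z (permLower B σ *ᵥ z) := by
      rw [reDot_mulVec_right, conjTranspose_conjTranspose, reDot_comm]
    simp only [reDot_add_left, reDot_add_right, reDot_smul_left, reDot_smul_right,
      reDot_comm _ z, h]
    ring
  have hz := reDot_self_nonneg z
  have hE₀ := hB.energySq_nonneg z
  have hE := hB.energySq_le hc z
  have hBz := hB.reDot_mulVec_self_le hc z
  have hdev : reDot (B *ᵥ z - z) (B *ᵥ z - z) ≤ (c ^ 2 + 1) * reDot z z := by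
    have hcE := mul_le_mul_of_nonneg_left hE (zero_le_one.trans hc1)
    simp only [reDot_sub_left, reDot_sub_right, reDot_comm (B *ᵥ z) z]
    rw [← energySq_eq_reDot]
    linarith
  have hcols : ∑ i, (reDot (B *ᵥ Pi.single i 1) (B *ᵥ Pi.single i 1) - 1) * Complex.normSq (z i) ≤
      (c - 1) * reDot z z := by
    rw [reDot_self_eq_sum z, Finset.mul_sum]
    refine Finset.sum_le_sum fun i _ => mul_le_mul_of_nonneg_right ?_ (Complex.normSq_nonneg _)
    have h := hB.reDot_mulVec_self_le hc (Pi.single i 1)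
    have hi : energySq B (Pi.single i 1) = 1 := by simp [energySq, hdiag]
    rw [hi, mul_one] at h
    linarith
  simp only [hexpand]
  rw [Finset.sum_add_distrib, ← Finset.mul_sum, sum_reDot_permLower_conjTranspose hB.1 hdiag,
    Finset.sum_const, Finset.card_univ, Fintype.card_perm, Fintype.card_fin, nsmul_eq_mul]
  set N := reDot z z
  have hkey : N + ω * (energySq B z - N) + ω ^ 2 * (1 / 3 * reDot (B *ᵥ z - z) (B *ᵥ z - z) +
      1 / 6 * ∑ i, (reDot (B *ᵥ Pi.single i 1) (B *ᵥ Pi.single i 1) - 1) * Complex.normSq (z i)) ≤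
      (1 + ω * c) ^ 2 * N := by
    have h₁ : ω * (energySq B z - N) ≤ ω * (2 * c * N) :=
      mul_le_mul_of_nonneg_left (by nlinarith) hω
    have h₂ : ω ^ 2 * (1 / 3 * reDot (B *ᵥ z - z) (B *ᵥ z - z) +
        1 / 6 * ∑ i, (reDot (B *ᵥ Pi.single i 1) (B *ᵥ Pi.single i 1) - 1) *
          Complex.normSq (z i)) ≤ ω ^ 2 * (c ^ 2 * N) := by
      refine mul_le_mul_of_nonneg_left ?_ (sq_nonneg ω)
      have : (1 / 3 * (c ^ 2 + 1) + 1 / 6 * (c - 1)) * N ≤ c ^ 2 * N :=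
        mul_le_mul_of_nonneg_right (by nlinarith) hz
      linarith
    linarith
  have := mul_le_mul_of_nonneg_left hkey (Nat.cast_nonneg (α := ℝ) n.factorial)
  linarith

/-- A lower bound, on average over all orderings, for the solutions of the triangular systems. -/
lemma factorial_mul_reDot_le_sum (hB : B.PosSemidef) (hdiag : ∀ i, B i i = 1)
    {c ω : ℝ} (hc : ∀ i, hB.1.eigenvalues i ≤ c) (hc1 : 1 ≤ c) (hω : 0 ≤ ω)
    {z : Fin n → ℂ} {w : Equiv.Perm (Fin n) → Fin n → ℂ}
    (hw : ∀ σ, w σ + (ω : ℂ) • (permLower B σ *ᵥ w σ) = z) :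
    n.factorial * reDot z z ≤ (1 + ω * c) ^ 2 * ∑ σ, reDot (w σ) (w σ) := by
  set b := (1 + ω * c) ^ 2 with hb
  have hb0 : 0 < b := by positivity
  have hpoint (σ : Equiv.Perm (Fin n)) : 2 * b * reDot z z ≤ b ^ 2 * reDot (w σ) (w σ) +
      reDot (z + (ω : ℂ) • ((permLower B σ)ᴴ *ᵥ z)) (z + (ω : ℂ) • ((permLower B σ)ᴴ *ᵥ z)) := by
    have h : reDot z z = reDot (w σ) (z + (ω : ℂ) • ((permLower B σ)ᴴ *ᵥ z)) := by
      nth_rewrite 1 [← hw σ]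
      rw [reDot_add_left, reDot_add_right, reDot_smul_left, reDot_smul_right,
        reDot_mulVec_right, conjTranspose_conjTranspose]
    rw [h]
    exact two_mul_reDot_le _ _ b
  have hsum := Finset.sum_le_sum fun σ (_ : σ ∈ Finset.univ) => hpoint σ
  rw [Finset.sum_const, Finset.card_univ, Fintype.card_perm, Fintype.card_fin, nsmul_eq_mul,
    Finset.sum_add_distrib, ← Finset.mul_sum] at hsum
  have hu := sum_reDot_add_smul_permLower_conjTranspose_le hB hdiag hc hc1 hω z
  rw [← hb] at hu
  refine le_of_mul_le_mul_left ?_ hb0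
  linarith

end SecondMoment

/-- Averaged contraction estimate: (1/n!) Σ_σ ⟨B Q_σ y, Q_σ y⟩ ≤ (1 − ω(2−ω)λ₁/((1+ωλ₁)²κ̄)) ⟨By, y⟩,
where Q_σ y = y − ω P_σ*(I + ωL_σ)⁻¹ P_σ B y. -/
theorem averaged_Q_energy_contraction {n : ℕ} (B : Matrix (Fin n) (Fin n) ℂ)
    (hB : B.PosSemidef) (hdiag : ∀ i, B i i = 1)
    (lam1 lamr : ℝ)
    (hlam1 : IsGreatest {μ : ℝ | ∃ i, hB.1.eigenvalues i = μ} lam1)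
    (hlamr : IsLeast {μ : ℝ | (∃ i, hB.1.eigenvalues i = μ) ∧ μ ≠ 0} lamr)
    (ω : ℝ) (hω0 : 0 < ω) (hω2 : ω < 2)
    (y : Fin n → ℂ) :
    (n.factorial : ℝ)⁻¹ *
        ∑ σ : Equiv.Perm (Fin n),
          energySq B (y - (ω : ℂ) • fun i =>
            ((1 + (ω : ℂ) • lowerTri (B.submatrix σ σ))⁻¹ *ᵥ fun j => (B *ᵥ y) (σ j))
              (σ.symm i))
      ≤ (1 - ω*(2-ω)*lam1 / ((1 + ω*lam1)^2 * (lam1/lamr))) * energySq B y := by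
  have hle (i) : hB.1.eigenvalues i ≤ lam1 := hlam1.2 ⟨i, rfl⟩
  have hge (i) (hi : hB.1.eigenvalues i ≠ 0) : lamr ≤ hB.1.eigenvalues i := hlamr.2 ⟨⟨i, rfl⟩, hi⟩
  obtain ⟨i, -⟩ := hlam1.1
  have hlam1_ge : 1 ≤ lam1 := by
    have h := hB.energySq_le hle (Pi.single i 1)
    simpa [energySq, reDot, ← Pi.single_star, hdiag] using h
  have hlow := hB.mul_energySq_le hge y
  set w : Equiv.Perm (Fin n) → Fin n → ℂ := fun σ i =>
    ((1 + (ω : ℂ) • lowerTri (B.submatrix σ σ))⁻¹ *ᵥ fun j => (B *ᵥ y) (σ j)) (σ.symm i)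
  have hw (σ) : w σ + (ω : ℂ) • (permLower B σ *ᵥ w σ) = B *ᵥ y :=
    permLower_solve σ (ω : ℂ) (B *ᵥ y)
  have hmean := factorial_mul_reDot_le_sum hB hdiag hle hlam1_ge hω0.le hw
  change (n.factorial : ℝ)⁻¹ * ∑ σ, energySq B (y - (ω : ℂ) • w σ) ≤ _
  simp only [energySq_sub_smul _ hB.1 hdiag ω (hw _)]
  rw [Finset.sum_sub_distrib, ← Finset.mul_sum, Finset.sum_const, Finset.card_univ,
    Fintype.card_perm, Fintype.card_fin, nsmul_eq_mul]
  have hn : (0 : ℝ) < n.factorial := by positivity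
  have hb : 0 < (1 + ω * lam1) ^ 2 := by positivity
  have hfactor : ω * (2 - ω) * lam1 / ((1 + ω * lam1) ^ 2 * (lam1 / lamr)) =
      ω * (2 - ω) * (lamr / (1 + ω * lam1) ^ 2) := by
    have : lam1 ≠ 0 := by positivity
    field_simp
  have hbound : lamr / (1 + ω * lam1) ^ 2 * energySq B y ≤
      (n.factorial : ℝ)⁻¹ * ∑ σ, reDot (w σ) (w σ) := by
    rw [div_mul_eq_mul_div, div_le_iff₀ hb, mul_assoc, inv_mul_eq_div, le_div_iff₀ hn]
    nlinarith
  have hscaled := mul_le_mul_of_nonneg_left hbound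
    (mul_nonneg hω0.le (sub_nonneg.mpr hω2.le))
  rw [hfactor, mul_sub, inv_mul_cancel_left₀ hn.ne']
  linarith
end
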